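/- For every positive integer n and every 0 ≤ k ≤ ⌊(n-1)/2⌋, the polynomial identity Σ_{σ ∈ S_n} q^{inv σ − exc σ} t^{exc σ} = Σ_{k=0}^{⌊(n-1)/2⌋} γ_{n,k}(q) t^k (1+t)^{n-1-2k} holds with γ_{n,k}(q) = Σ_{σ ∈ S_{n,k}} q^{2·res σ + les σ}, where S_{n,k} is the set of permutations of [n] with exactly k valleys and no double descents. -/

import Mathlib

open Finset MvPolynomial

/-- The value `σ(i)` for a permutation of `{1,…,n}` encoded as `Equiv.Perm (Fin n)`,
with the convention `σ(i) = 0` for `i = 0` and `i = n+1` (indeed for all `i ∉ [n]`). -/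
def pval (n : ℕ) (σ : Equiv.Perm (Fin n)) (i : ℕ) : ℕ :=
  if h : 1 ≤ i ∧ i ≤ n then ((σ ⟨i - 1, by omega⟩ : Fin n) : ℕ) + 1 else 0

/-- Number of inversions: pairs `1 ≤ i < j ≤ n` with `σ(i) > σ(j)`. -/
def inv (n : ℕ) (σ : Equiv.Perm (Fin n)) : ℕ :=
  ((Finset.Icc 1 n ×ˢ Finset.Icc 1 n).filter
    (fun p => p.1 < p.2 ∧ pval n σ p.2 < pval n σ p.1)).card

/-- Number of excedances: indices `i ∈ [n]` with `i < σ(i)`. -/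
def exc (n : ℕ) (σ : Equiv.Perm (Fin n)) : ℕ :=
  ((Finset.Icc 1 n).filter (fun i => i < pval n σ i)).card

/-- Number of drops: indices `i ∈ [n]` with `i > σ(i)`. -/
def drp (n : ℕ) (σ : Equiv.Perm (Fin n)) : ℕ :=
  ((Finset.Icc 1 n).filter (fun i => pval n σ i < i)).card

/-- Number of descents: indices `1 ≤ i < n` with `σ(i) > σ(i+1)`. -/
def des (n : ℕ) (σ : Equiv.Perm (Fin n)) : ℕ :=
  ((Finset.Icc 1 (n - 1)).filter (fun i => pval n σ (i + 1) < pval n σ i)).card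

/-- `les σ`: number of pairs `2 ≤ i < j ≤ n` with `σ(i-1) > σ(j) > σ(i)`. -/
def les (n : ℕ) (σ : Equiv.Perm (Fin n)) : ℕ :=
  ((Finset.Icc 2 n ×ˢ Finset.Icc 2 n).filter
    (fun p => p.1 < p.2 ∧ pval n σ p.2 < pval n σ (p.1 - 1) ∧
      pval n σ p.1 < pval n σ p.2)).card

/-- `res σ`: number of pairs `1 ≤ i < j ≤ n-1` with `σ(j+1) > σ(i) > σ(j)`. -/
def res (n : ℕ) (σ : Equiv.Perm (Fin n)) : ℕ :=
  ((Finset.Icc 1 (n - 1) ×ˢ Finset.Icc 1 (n - 1)).filter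
    (fun p => p.1 < p.2 ∧ pval n σ p.2 < pval n σ p.1 ∧
      pval n σ p.1 < pval n σ (p.2 + 1))).card

/-- `ress σ`: number of pairs `1 ≤ i < j ≤ n-1` with `σ(j+1) < σ(i) < σ(j)`. -/
def ress (n : ℕ) (σ : Equiv.Perm (Fin n)) : ℕ :=
  ((Finset.Icc 1 (n - 1) ×ˢ Finset.Icc 1 (n - 1)).filter
    (fun p => p.1 < p.2 ∧ pval n σ (p.2 + 1) < pval n σ p.1 ∧
      pval n σ p.1 < pval n σ p.2)).card

/-- Crossing number: pairs `(i,j) ∈ [n]×[n]` with `i < j ≤ σ(i) < σ(j)` or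
`i > j > σ(i) > σ(j)`. -/
def cros (n : ℕ) (σ : Equiv.Perm (Fin n)) : ℕ :=
  ((Finset.Icc 1 n ×ˢ Finset.Icc 1 n).filter
    (fun p => (p.1 < p.2 ∧ p.2 ≤ pval n σ p.1 ∧ pval n σ p.1 < pval n σ p.2) ∨
      (p.2 < p.1 ∧ pval n σ p.1 < p.2 ∧ pval n σ p.2 < pval n σ p.1))).card

/-- Nesting number: pairs `(i,j) ∈ [n]×[n]` with `i < j ≤ σ(j) < σ(i)` or
`i > j > σ(j) > σ(i)`. -/
def nest (n : ℕ) (σ : Equiv.Perm (Fin n)) : ℕ :=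
  ((Finset.Icc 1 n ×ˢ Finset.Icc 1 n).filter
    (fun p => (p.1 < p.2 ∧ p.2 ≤ pval n σ p.2 ∧ pval n σ p.2 < pval n σ p.1) ∨
      (p.2 < p.1 ∧ pval n σ p.2 < p.2 ∧ pval n σ p.1 < pval n σ p.2))).card

/-- Number of valleys: `i ∈ [n]` with `σ(i-1) > σ(i)` and `σ(i) < σ(i+1)`
(convention `σ(0) = σ(n+1) = 0`). -/
def valleys (n : ℕ) (σ : Equiv.Perm (Fin n)) : ℕ :=
  ((Finset.Icc 1 n).filter
    (fun i => pval n σ i < pval n σ (i - 1) ∧ pval n σ i < pval n σ (i + 1))).card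

/-- Number of double descents: `i ∈ [n]` with `σ(i-1) > σ(i)` and `σ(i) > σ(i+1)`
(convention `σ(0) = σ(n+1) = 0`). -/
def ddes (n : ℕ) (σ : Equiv.Perm (Fin n)) : ℕ :=
  ((Finset.Icc 1 n).filter
    (fun i => pval n σ i < pval n σ (i - 1) ∧ pval n σ (i + 1) < pval n σ i)).card

/-- `S_{n,k}`: permutations of `[n]` with exactly `k` valleys and no double descents. -/
def Snk (n k : ℕ) : Finset (Equiv.Perm (Fin n)) :=
  Finset.univ.filter (fun σ => valleys n σ = k ∧ ddes n σ = 0)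

/-- The permutation sending `p` to `v` and order-isomorphic to `τ` off `p`. -/
def insertPoint {N : ℕ} (p v : Fin (N + 1)) (τ : Equiv.Perm (Fin N)) :
    Equiv.Perm (Fin (N + 1)) :=
  (finSuccEquiv' p).trans ((Equiv.optionCongr τ).trans (finSuccEquiv' v).symm)

section InsertPoint

variable {N : ℕ} (p v : Fin (N + 1)) (τ : Equiv.Perm (Fin N))

@[simp]
lemma insertPoint_self : insertPoint p v τ p = v := by simp [insertPoint]

@[simp]
lemma insertPoint_succAbove (i : Fin N) :
    insertPoint p v τ (p.succAbove i) = v.succAbove (τ i) := by simp [insertPoint]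

lemma insertPoint_inj {p p' v v' : Fin (N + 1)} {τ τ' : Equiv.Perm (Fin N)}
    (hpv : p = p' ∨ v = v') (h : insertPoint p v τ = insertPoint p' v' τ') :
    p = p' ∧ v = v' ∧ τ = τ' := by
  have key : p = p' ∧ v = v' := by
    rcases hpv with rfl | rfl
    · exact ⟨rfl, by simpa using DFunLike.congr_fun h p⟩
    · refine ⟨(insertPoint p v τ).injective ?_, rfl⟩
      conv_rhs => rw [h]
      simp
  obtain ⟨rfl, rfl⟩ := key
  refine ⟨rfl, rfl, Equiv.ext fun i => ?_⟩
  simpa using DFunLike.congr_fun h (p.succAbove i)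

lemma sum_insertPoint_position {M : Type*} [AddCommMonoid M]
    (f : Equiv.Perm (Fin (N + 1)) → M) :
    ∑ π, f π = ∑ p, ∑ τ, f (insertPoint p v τ) := by
  rw [← Fintype.sum_prod_type']
  refine (Function.Bijective.sum_comp (e := fun x : Fin (N + 1) × Equiv.Perm (Fin N) =>
    insertPoint x.1 v x.2) ?_ f).symm
  rw [Fintype.bijective_iff_injective_and_card]
  refine ⟨fun x y h => ?_, by simp [Fintype.card_perm, Nat.factorial_succ]⟩
  obtain ⟨h1, -, h2⟩ := insertPoint_inj (Or.inr rfl) h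
  exact Prod.ext h1 h2

lemma sum_insertPoint_value {M : Type*} [AddCommMonoid M]
    (f : Equiv.Perm (Fin (N + 1)) → M) :
    ∑ π, f π = ∑ v, ∑ τ, f (insertPoint p v τ) := by
  rw [← Fintype.sum_prod_type']
  refine (Function.Bijective.sum_comp (e := fun x : Fin (N + 1) × Equiv.Perm (Fin N) =>
    insertPoint p x.1 x.2) ?_ f).symm
  rw [Fintype.bijective_iff_injective_and_card]
  refine ⟨fun x y h => ?_, by simp [Fintype.card_perm, Nat.factorial_succ]⟩
  obtain ⟨-, h1, h2⟩ := insertPoint_inj (Or.inl rfl) h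
  exact Prod.ext h1 h2

end InsertPoint

/-- Number of inversions, as a double sum. -/
def invCount {N : ℕ} (π : Equiv.Perm (Fin N)) : ℕ :=
  ∑ i, ∑ j, if i < j ∧ π j < π i then 1 else 0

/-- Number of excedances, as a sum. -/
def excCount {N : ℕ} (π : Equiv.Perm (Fin N)) : ℕ :=
  ∑ i, if i < π i then 1 else 0

lemma invCount_insertPoint {N : ℕ} (p v : Fin (N + 1)) (τ : Equiv.Perm (Fin N)) :
    invCount (insertPoint p v τ) = invCount τ +
      (∑ j, if p ≤ j.castSucc ∧ (τ j).castSucc < v then 1 else 0) +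
      ∑ i, if i.castSucc < p ∧ v ≤ (τ i).castSucc then 1 else 0 := by
  simp only [invCount, Fin.sum_univ_succAbove _ p, insertPoint_self, insertPoint_succAbove,
    Fin.succAbove_lt_succAbove_iff, Fin.lt_succAbove_iff_le_castSucc,
    Fin.succAbove_lt_iff_castSucc_lt, lt_irrefl, Finset.sum_add_distrib]
  simp
  ring

lemma excCount_insertPoint {N : ℕ} (p v : Fin (N + 1)) (τ : Equiv.Perm (Fin N)) :
    excCount (insertPoint p v τ) = (if p < v then 1 else 0) +
      ∑ i, if p.succAbove i < v.succAbove (τ i) then 1 else 0 := by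
  simp only [excCount, Fin.sum_univ_succAbove _ p, insertPoint_self, insertPoint_succAbove]

lemma excCount_le_invCount {N : ℕ} (π : Equiv.Perm (Fin N)) : excCount π ≤ invCount π := by
  refine Finset.sum_le_sum fun i _ => ?_
  split_ifs with hi
  · by_contra hlt
    have h0 : ∀ j, i < j → π i < π j := by
      intro j hj
      by_contra hle
      have hne : π j ≠ π i := fun h => hj.ne' (π.injective h)
      have : 1 ≤ ∑ j, if i < j ∧ π j < π i then 1 else 0 := by
        refine le_trans ?_ (Finset.single_le_sum (fun _ _ => Nat.zero_le _) (Finset.mem_univ j))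
        rw [if_pos ⟨hj, lt_of_le_of_ne (not_lt.mp hle) hne⟩]
      exact hlt this
    have hcard : (Finset.Ioi i).card ≤ (Finset.Ioi (π i)).card :=
      Finset.card_le_card_of_injOn π (fun j hj => by simpa using h0 j (by simpa using hj))
        π.injective.injOn
    rw [Fin.card_Ioi, Fin.card_Ioi] at hcard
    have := (π i).isLt
    have : (i : ℕ) < π i := hi
    omega
  · exact Nat.zero_le _

/-- `∑_{p<k} q^(k-1+p)`, the weight with which a state with `k` open slots closes one. -/
def slotWeight {R : Type*} [CommSemiring R] (q : R) : ℕ → R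
  | 0 => 0
  | k + 1 => q ^ (2 * k) + q * slotWeight q k

lemma slotWeight_succ_eq_sum {R : Type*} [CommSemiring R] (q : R) (h : ℕ) :
    slotWeight q (h + 1) = ∑ p ∈ Finset.range (h + 1), q ^ (h + p) := by
  induction h with
  | zero => simp [slotWeight]
  | succ h ih =>
    rw [slotWeight, ih, Finset.mul_sum, Finset.sum_range_succ _ (h + 1), add_comm]
    congr 1
    · exact Finset.sum_congr rfl fun p _ => by ring
    · ring

lemma sum_fin_ite_lt {M : Type*} [AddCommMonoid M] {N h : ℕ} (hN : h ≤ N) (f : ℕ → M) :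
    (∑ p : Fin N, if (p : ℕ) < h then f p else 0) = ∑ p ∈ Finset.range h, f p := by
  rw [Fin.sum_univ_eq_sum_range (fun p => if p < h then f p else 0) N, ← Finset.sum_filter]
  refine Finset.sum_congr ?_ fun _ _ => rfl
  ext x
  simp only [Finset.mem_filter, Finset.mem_range]
  omega

/-- The first `a` positions avoid the `b` smallest values. -/
def AvoidsCorner {N : ℕ} (a b : ℕ) (π : Equiv.Perm (Fin N)) : Prop :=
  ∀ i : Fin N, (i : ℕ) < a → b ≤ (π i : ℕ)

instance {N : ℕ} (a b : ℕ) : DecidablePred (AvoidsCorner (N := N) a b) :=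
  fun _ => inferInstanceAs (Decidable (∀ _, _))

/-- Generating polynomial of `(inv - exc, exc)` over the permutations whose first `a` positions
avoid the `b` smallest values. -/
def cornerSum {R : Type*} [CommSemiring R] (q t : R) (N a b : ℕ) : R :=
  ∑ π : Equiv.Perm (Fin N),
    if AvoidsCorner a b π then q ^ (invCount π - excCount π) * t ^ excCount π else 0

lemma card_perm_castSucc_lt {N : ℕ} (τ : Equiv.Perm (Fin N)) (v : Fin (N + 1)) :
    (∑ j, if (τ j).castSucc < v then 1 else 0) = (v : ℕ) := by
  rw [Equiv.sum_comp τ (fun x => if x.castSucc < v then 1 else 0)]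
  have := sum_fin_ite_lt (Nat.lt_succ_iff.mp v.isLt) (fun _ => 1)
  simpa [Fin.lt_def] using this

lemma card_castSucc_lt {N : ℕ} (p : Fin (N + 1)) :
    (∑ j : Fin N, if j.castSucc < p then 1 else 0) = (p : ℕ) :=
  card_perm_castSucc_lt (Equiv.refl _) p

lemma invCount_insertPoint_of_corner {N : ℕ} {p v : Fin (N + 1)} {τ : Equiv.Perm (Fin N)}
    (hτ : ∀ i : Fin N, (i : ℕ) < p → (v : ℕ) ≤ τ i) :
    invCount (insertPoint p v τ) = invCount τ + v + p := by
  rw [invCount_insertPoint]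
  congr 2
  · conv_rhs => rw [← card_perm_castSucc_lt τ v]
    refine Finset.sum_congr rfl fun j _ => if_congr ?_ rfl rfl
    have := hτ j
    simp only [Fin.lt_def, Fin.le_def, Fin.val_castSucc]
    omega
  · conv_rhs => rw [← card_castSucc_lt p]
    refine Finset.sum_congr rfl fun j _ => if_congr ?_ rfl rfl
    have := hτ j
    simp only [Fin.lt_def, Fin.le_def, Fin.val_castSucc]
    omega

lemma val_succAbove_eq_ite {N : ℕ} (p : Fin (N + 1)) (i : Fin N) :
    (p.succAbove i : ℕ) = if (i : ℕ) < p then (i : ℕ) else i + 1 := by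
  unfold Fin.succAbove
  simp only [Fin.lt_def, Fin.val_castSucc]
  split_ifs <;> simp

lemma forall_fin_succAbove {N : ℕ} (p : Fin (N + 1)) {P : Fin (N + 1) → Prop} :
    (∀ i, P i) ↔ P p ∧ ∀ i, P (p.succAbove i) :=
  Fin.forall_iff_succAbove p

lemma cornerSum_value_step {R : Type*} [CommSemiring R] (q t : R) {N h : ℕ} (hN : h + 1 ≤ N) :
    cornerSum q t (N + 1) (h + 1) (h + 1) = cornerSum q t (N + 1) (h + 1) (h + 2) +
      t * slotWeight q (h + 1) * cornerSum q t N h (h + 1) := by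
  set v : Fin (N + 1) := ⟨h + 1, by omega⟩ with hv
  have split : cornerSum q t (N + 1) (h + 1) (h + 1) = cornerSum q t (N + 1) (h + 1) (h + 2) +
      ∑ π : Equiv.Perm (Fin (N + 1)),
        if AvoidsCorner (h + 1) (h + 1) π ∧ ¬ AvoidsCorner (h + 1) (h + 2) π then
          q ^ (invCount π - excCount π) * t ^ excCount π else 0 := by
    simp only [cornerSum, ← Finset.sum_add_distrib]
    refine Finset.sum_congr rfl fun π _ => ?_
    have : AvoidsCorner (h + 1) (h + 2) π → AvoidsCorner (h + 1) (h + 1) π :=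
      fun H i hi => (Nat.le_succ _).trans (H i hi)
    by_cases h1 : AvoidsCorner (h + 1) (h + 2) π <;> simp_all
  rw [split, sum_insertPoint_position v, slotWeight_succ_eq_sum, Finset.mul_sum, Finset.sum_mul,
    ← sum_fin_ite_lt (show h + 1 ≤ N + 1 by omega)]
  congr 1
  refine Finset.sum_congr rfl fun p _ => ?_
  have hiff : ∀ τ, (AvoidsCorner (h + 1) (h + 1) (insertPoint p v τ) ∧
      ¬ AvoidsCorner (h + 1) (h + 2) (insertPoint p v τ)) ↔
      (p : ℕ) < h + 1 ∧ AvoidsCorner h (h + 1) τ := by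
    intro τ
    simp only [AvoidsCorner, forall_fin_succAbove p, insertPoint_self, insertPoint_succAbove,
      val_succAbove_eq_ite]
    constructor
    · rintro ⟨⟨-, h2⟩, h3⟩
      have hp : (p : ℕ) < h + 1 := by
        by_contra hp
        refine h3 ⟨fun h => absurd h hp, fun i hi => ?_⟩
        have := h2 i hi
        simp only [hv] at this ⊢
        split_ifs at this ⊢ <;> omega
      refine ⟨hp, fun i hi => ?_⟩
      have := h2 i (by split_ifs <;> omega)
      simp only [hv] at this
      split_ifs at this <;> omega
    · rintro ⟨hp, h1⟩
      refine ⟨⟨fun _ => le_rfl, fun i hi => ?_⟩, fun h2 => ?_⟩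
      · have := h1 i (by split_ifs at hi <;> omega)
        simp only [hv]
        split_ifs <;> omega
      · have := h2.1 hp
        simp [hv] at this
  simp only [hiff]
  split_ifs with hp
  · rw [cornerSum, Finset.mul_sum]
    refine Finset.sum_congr rfl fun τ _ => ?_
    by_cases hτ : AvoidsCorner h (h + 1) τ
    · rw [if_pos ⟨hp, hτ⟩, if_pos hτ]
      have e1 : invCount (insertPoint p v τ) = invCount τ + (h + 1) + p :=
        invCount_insertPoint_of_corner fun i hi => hτ i (by omega)
      have e2 : excCount (insertPoint p v τ) = 1 + excCount τ := by
        rw [excCount_insertPoint, if_pos (by simpa [Fin.lt_def, hv] using hp), excCount]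
        congr 1
        refine Finset.sum_congr rfl fun i _ => if_congr ?_ rfl rfl
        simp only [Fin.lt_def, val_succAbove_eq_ite, hv]
        have := hτ i
        split_ifs <;> omega
      have e3 := excCount_le_invCount τ
      rw [e1, e2, show invCount τ + (h + 1) + p - (1 + excCount τ) =
        (invCount τ - excCount τ) + (h + p) by omega]
      ring
    · rw [if_neg (fun H => hτ H.2), if_neg hτ, mul_zero]
  · simp [hp]

lemma cornerSum_position_step {R : Type*} [CommSemiring R] (q t : R) {N h : ℕ} (hN : h ≤ N) :
    cornerSum q t (N + 1) h (h + 1) = cornerSum q t (N + 1) (h + 1) (h + 1) +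
      slotWeight q (h + 1) * cornerSum q t N h h := by
  set p : Fin (N + 1) := ⟨h, by omega⟩ with hp
  have split : cornerSum q t (N + 1) h (h + 1) = cornerSum q t (N + 1) (h + 1) (h + 1) +
      ∑ π : Equiv.Perm (Fin (N + 1)),
        if AvoidsCorner h (h + 1) π ∧ ¬ AvoidsCorner (h + 1) (h + 1) π then
          q ^ (invCount π - excCount π) * t ^ excCount π else 0 := by
    simp only [cornerSum, ← Finset.sum_add_distrib]
    refine Finset.sum_congr rfl fun π _ => ?_
    have : AvoidsCorner (h + 1) (h + 1) π → AvoidsCorner h (h + 1) π :=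
      fun H i hi => H i (hi.trans (Nat.lt_succ_self _))
    by_cases h1 : AvoidsCorner (h + 1) (h + 1) π <;> simp_all
  rw [split, sum_insertPoint_value p, slotWeight_succ_eq_sum, Finset.sum_mul,
    ← sum_fin_ite_lt (show h + 1 ≤ N + 1 by omega)]
  congr 1
  refine Finset.sum_congr rfl fun v _ => ?_
  have hiff : ∀ τ, (AvoidsCorner h (h + 1) (insertPoint p v τ) ∧
      ¬ AvoidsCorner (h + 1) (h + 1) (insertPoint p v τ)) ↔
      (v : ℕ) < h + 1 ∧ AvoidsCorner h h τ := by
    intro τ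
    simp only [AvoidsCorner, forall_fin_succAbove p, insertPoint_self, insertPoint_succAbove,
      val_succAbove_eq_ite, hp]
    constructor
    · rintro ⟨⟨-, h2⟩, h3⟩
      have hv : (v : ℕ) < h + 1 := by
        by_contra hv
        refine h3 ⟨fun _ => not_lt.mp hv, fun i hi => ?_⟩
        exact h2 i (by split_ifs at hi ⊢ <;> omega)
      refine ⟨hv, fun i hi => ?_⟩
      have := h2 i (by split_ifs; omega)
      split_ifs at this <;> omega
    · rintro ⟨hv, h1⟩
      refine ⟨⟨fun h => by omega, fun i hi => ?_⟩, fun h2 => ?_⟩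
      · have := h1 i (by split_ifs at hi <;> omega)
        split_ifs <;> omega
      · have := h2.1 (by omega)
        omega
  simp only [hiff]
  split_ifs with hv
  · rw [cornerSum, Finset.mul_sum]
    refine Finset.sum_congr rfl fun τ _ => ?_
    by_cases hτ : AvoidsCorner h h τ
    · rw [if_pos ⟨hv, hτ⟩, if_pos hτ]
      have e1 : invCount (insertPoint p v τ) = invCount τ + v + h :=
        invCount_insertPoint_of_corner fun i hi => by
          have := hτ i hi
          omega
      have e2 : excCount (insertPoint p v τ) = excCount τ := by
        rw [excCount_insertPoint, if_neg (by simp only [Fin.lt_def, hp]; omega), excCount, zero_add]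
        refine Finset.sum_congr rfl fun i _ => if_congr ?_ rfl rfl
        simp only [Fin.lt_def, val_succAbove_eq_ite, hp]
        have := hτ i
        split_ifs <;> omega
      have e3 := excCount_le_invCount τ
      rw [e1, e2, show invCount τ + v + h - excCount τ =
        (invCount τ - excCount τ) + (h + v) by omega]
      ring
    · rw [if_neg (fun H => hτ H.2), if_neg hτ, mul_zero]
  · simp [hv]

lemma cornerSum_self_eq_zero {R : Type*} [CommSemiring R] (q t : R) (h : ℕ) :
    cornerSum q t (h + 1) (h + 1) (h + 1) = 0 := by
  refine Finset.sum_eq_zero fun π _ => if_neg fun H => ?_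
  have := H 0 (by simp)
  omega

lemma cornerSum_zero_left {R : Type*} [CommSemiring R] (q t : R) (N b b' : ℕ) :
    cornerSum q t N 0 b = cornerSum q t N 0 b' := by
  simp [cornerSum, AvoidsCorner]

/-- Total weight of the lattice paths from height `k` to height `0` with `m` steps, with rising
weight `t`, level weight `b` and an extra factor `slotWeight q k` for a step from height `k`. -/
def pathWeight {R : Type*} [CommSemiring R] (q t b : R) : ℕ → ℕ → R
  | 0, k => if k = 0 then 1 else 0
  | _ + 1, 0 => 0
  | m + 1, k + 1 => slotWeight q (k + 1) *
      (pathWeight q t b m k + b * pathWeight q t b m (k + 1) + t * pathWeight q t b m (k + 2))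

lemma cornerSum_self_recursion {R : Type*} [CommSemiring R] (q t : R) (m h : ℕ) :
    cornerSum q t (m + h + 2) (h + 1) (h + 1) = cornerSum q t (m + h + 2) (h + 1) (h + 2) +
      t * slotWeight q (h + 1) * cornerSum q t (m + h + 1) h (h + 1) :=
  cornerSum_value_step q t (by omega)

lemma cornerSum_eq_pathWeight {R : Type*} [CommSemiring R] (q t : R) (m h : ℕ) :
    cornerSum q t (m + h + 1) h (h + 1) =
      (∏ i ∈ Finset.range h, (t * slotWeight q (i + 1))) *
        pathWeight q t (1 + t) (m + 1) (h + 1) := by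
  induction m generalizing h with
  | zero =>
    rw [zero_add, cornerSum_position_step q t le_rfl, cornerSum_self_eq_zero, zero_add]
    cases h with
    | zero => simp [pathWeight, cornerSum, AvoidsCorner, invCount, excCount]
    | succ h => simp [pathWeight, cornerSum_self_eq_zero]
  | succ m ih =>
    rw [show m + 1 + h + 1 = (m + h + 1) + 1 by omega, cornerSum_position_step q t (by omega),
      cornerSum_self_recursion, show m + h + 2 = m + (h + 1) + 1 by omega, ih, ih]
    conv_rhs => rw [pathWeight]
    cases h with
    | zero =>
      have h0 := ih 0
      rw [add_zero] at h0 ⊢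
      rw [cornerSum_zero_left q t _ 0 (0 + 1), h0]
      simp only [zero_add, pathWeight.eq_2, Finset.prod_range_succ, Finset.prod_range_zero]
      ring
    | succ h =>
      rw [show m + (h + 1) + 1 = m + h + 2 by omega, cornerSum_self_recursion, ih,
        show m + h + 2 = m + (h + 1) + 1 by omega, ih]
      simp only [Finset.prod_range_succ]
      ring

lemma slotWeight_one (k : ℕ) : slotWeight (1 : ℕ) k = k := by
  induction k with
  | zero => rfl
  | succ k ih => simp [slotWeight, ih, add_comm]

lemma pathWeight_one (m k : ℕ) :
    pathWeight (1 : ℕ) 1 2 (m + 1) (k + 1) = (m + 1).factorial * m.choose k := by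
  induction m generalizing k with
  | zero =>
    cases k <;> simp [pathWeight, slotWeight_one]
  | succ m ih =>
    rw [pathWeight, slotWeight_one, ih, ih, Nat.factorial_succ (m + 1)]
    have h1 := Nat.add_one_mul_choose_eq (m + 1) k
    have h2 := Nat.choose_succ_succ m k
    cases k with
    | zero =>
      simp [pathWeight]
      ring
    | succ k =>
      rw [ih]
      have h3 := Nat.choose_succ_succ (m + 1) (k + 1)
      have h5 := Nat.choose_succ_succ m k
      simp only [Nat.succ_eq_add_one] at h2 h3 h5
      calc _ = (m + 1).factorial * ((k + 1 + 1) * (m + 1 + 1).choose (k + 1 + 1)) := by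
            rw [h3, h5, h2]; ring
        _ = _ := by rw [mul_comm (k + 1 + 1), ← h1]; ring

/-- Number of adjacent pairs `x, y` (in this order) with `x < c < y`. -/
def upAcross (c : ℕ) : List ℕ → ℕ
  | [] => 0
  | x :: l => (if x < c ∧ c < l.headD 0 then 1 else 0) + upAcross c l

/-- Number of occurrences of the pattern `2-13` in a word. -/
def resWord : List ℕ → ℕ
  | [] => 0
  | c :: l => upAcross c l + resWord l

/-- Weight of a letter `y` with neighbours `x` and `z`: valleys weigh `t`, double ascents `a`,
double descents `d` and peaks `1`. -/
def letterWeight {R : Type*} [CommSemiring R] (t a d : R) (x y z : ℕ) : R :=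
  if y < x then (if y < z then t else d) else (if y < z then a else 1)

/-- Product of the letter weights of a word preceded by the letter `x` and followed by `0`. -/
def shapeWeight {R : Type*} [CommSemiring R] (t a d : R) : ℕ → List ℕ → R
  | _, [] => 1
  | x, y :: l => letterWeight t a d x y (l.headD 0) * shapeWeight t a d y l

/-- Weight of a word: `2-13` patterns weigh `q²`, `31-2` patterns weigh `q`. -/
def wordWeight {R : Type*} [CommSemiring R] (q t a d : R) (w : List ℕ) : R :=
  q ^ (2 * resWord w + resWord w.reverse) * shapeWeight t a d 0 w

/-- The ways to insert the letter `v` at a marker `N`. -/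
def slotFillings (N v : ℕ) : List (List ℕ) := [[v], [N, v], [v, N], [N, v, N]]

/-- Words with letters below `v` and pairwise nonadjacent markers `N`. -/
structure IsMarked (N v : ℕ) (w : List ℕ) : Prop where
  lt_or_eq : ∀ x ∈ w, x < v ∨ x = N
  isChain : w.IsChain fun x y => x ≠ N ∨ y ≠ N

namespace IsMarked

variable {N v x : ℕ} {w r : List ℕ}

lemma tail (h : IsMarked N v (x :: w)) : IsMarked N v w :=
  ⟨fun y hy => h.1 y (List.mem_cons_of_mem _ hy), h.2.tail⟩

lemma reverse (h : IsMarked N v w) : IsMarked N v w.reverse := by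
  refine ⟨fun y hy => h.1 y (List.mem_reverse.mp hy), ?_⟩
  rw [List.isChain_reverse]
  exact h.2.imp fun a b hab => hab.symm

lemma headD_lt (h : IsMarked N v (N :: r)) (hv : 0 < v) : r.headD 0 < v := by
  cases r with
  | nil => exact hv
  | cons y r =>
    have h1 := h.1 y (by simp)
    have h2 := h.2
    simp only [List.isChain_cons_cons] at h2
    simp only [List.headD_cons]
    rcases h1 with h1 | h1
    · exact h1
    · simp [h1] at h2

lemma upAcross_add (h : IsMarked N v w) (h0 : 0 < v) (hv : v < N) :
    upAcross v w + (if w.headD 0 = N then 1 else 0) = w.count N := by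
  induction w with
  | nil => simp [upAcross]; omega
  | cons x w ih =>
    have ih := ih h.tail
    have hhead : (if (x :: w).headD 0 = N then 1 else 0) = if x = N then 1 else 0 := rfl
    rw [upAcross, hhead]
    rcases h.1 x (by simp) with hx | rfl
    · have hw : v < w.headD 0 ↔ w.headD 0 = N := by
        cases w with
        | nil => simp; omega
        | cons y w =>
          have := h.1 y (by simp)
          simp only [List.headD_cons]
          omega
      have hxN : ¬ x = N := by omega
      rw [List.count_cons_of_ne hxN, ← ih, if_neg hxN]
      simp only [hx, hw, true_and]
      ring
    · have := h.headD_lt h0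
      rw [List.count_cons_self, ← ih, if_neg (by omega), if_pos rfl, if_neg (by omega)]
      ring

end IsMarked

lemma upAcross_eq_zero {c : ℕ} {w : List ℕ} (h : ∀ x ∈ w, x ≤ c) : upAcross c w = 0 := by
  induction w with
  | nil => rfl
  | cons x w ih =>
    rw [upAcross, ih fun y hy => h y (List.mem_cons_of_mem _ hy), if_neg]
    rintro ⟨-, h2⟩
    cases w with
    | nil => simp at h2
    | cons y w =>
      have := h y (by simp)
      simp at h2
      omega

lemma upAcross_replace {N v c : ℕ} {l m r : List ℕ} (hc : c < v) (hv : v < N)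
    (hm : m ∈ slotFillings N v) : upAcross c (l ++ (m ++ r)) = upAcross c (l ++ N :: r) := by
  induction l with
  | nil =>
    simp only [slotFillings, List.mem_cons, List.not_mem_nil, or_false] at hm
    rcases hm with rfl | rfl | rfl | rfl <;>
      simp [upAcross, -List.headD_eq_head?_getD, hc, hc.trans hv, (hc.trans hv).not_gt, hc.not_gt]
  | cons x l ih =>
    simp only [List.cons_append, upAcross, ih]
    congr 2
    cases l with
    | nil =>
      simp only [slotFillings, List.mem_cons, List.not_mem_nil, or_false] at hm
      rcases hm with rfl | rfl | rfl | rfl <;> simp [hc, hc.trans hv]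
    | cons y l => rfl

lemma resWord_replace {N v : ℕ} {l m r : List ℕ} (h0 : 0 < v) (hv : v < N)
    (hw : IsMarked N v (l ++ N :: r)) (hm : m ∈ slotFillings N v) :
    resWord (l ++ (m ++ r)) = resWord (l ++ N :: r) + r.count N := by
  induction l with
  | nil =>
    have hr : IsMarked N v r := IsMarked.tail hw
    have h1 := hr.upAcross_add h0 hv
    have h2 := IsMarked.headD_lt hw h0
    rw [if_neg (by omega)] at h1
    have h3 : ∀ l : List ℕ, (∀ x ∈ l, x = v ∨ x ∈ r) → upAcross N l = 0 := fun l hl =>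
      upAcross_eq_zero fun x hx => by
        rcases hl x hx with rfl | h
        · exact hv.le
        · have := hr.1 x h
          omega
    have h4 := h3 r fun _ => Or.inr
    have h5 := h3 (v :: r) fun _ => List.mem_cons.mp
    have h6 : upAcross N (v :: N :: r) = 0 := by
      simp [upAcross, h4]
    have h7 : upAcross N (N :: r) = 0 := by simp [upAcross, h4]
    have h8 : upAcross v (N :: r) = r.count N := by
      rw [upAcross, if_neg (by omega)]
      omega
    simp only [slotFillings, List.mem_cons, List.not_mem_nil, or_false] at hm
    rcases hm with rfl | rfl | rfl | rfl <;> simp [resWord, *] <;> omega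
  | cons x l ih =>
    simp only [List.cons_append, resWord]
    rw [ih (IsMarked.tail hw)]
    rcases hw.1 x (by simp) with hx | rfl
    · rw [upAcross_replace hx hv hm]
      ring
    · rw [upAcross_eq_zero, upAcross_eq_zero, zero_add, zero_add]
      · intro y hy
        have := hw.1 y (List.mem_cons_of_mem _ hy)
        omega
      · intro y hy
        have h1 := hw.1 y
        simp only [List.mem_append, List.cons_append, List.mem_cons] at hy h1
        simp only [slotFillings, List.mem_cons, List.not_mem_nil, or_false] at hm
        rcases hm with rfl | rfl | rfl | rfl <;> simp at hy <;> grind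

lemma shapeWeight_congr_left {R : Type*} [CommSemiring R] (t a d : R) {x x' : ℕ} {l : List ℕ}
    (hx : l.headD 0 < x) (hx' : l.headD 0 < x') :
    shapeWeight t a d x l = shapeWeight t a d x' l := by
  cases l with
  | nil => rfl
  | cons y l =>
    simp only [List.headD_cons] at hx hx'
    simp [shapeWeight, letterWeight, hx, hx']

/-- Weight of the letter `v` inserted as in a given slot filling. -/
def fillingWeight {R : Type*} [CommSemiring R] (t a d : R) (N v : ℕ) (m : List ℕ) : R :=
  if m = [v] then 1 else if m = [N, v] then d else if m = [v, N] then a else t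

lemma shapeWeight_replace {R : Type*} [CommSemiring R] (t a d : R) {N v x : ℕ} {l m r : List ℕ}
    (h0 : 0 < v) (hv : v < N) (hw : IsMarked N v (x :: (l ++ N :: r)))
    (hm : m ∈ slotFillings N v) :
    shapeWeight t a d x (l ++ (m ++ r)) =
      fillingWeight t a d N v m * shapeWeight t a d x (l ++ N :: r) := by
  induction l generalizing x with
  | nil =>
    have hx : x < v := by
      have h1 := hw.1 x (by simp)
      have h2 := hw.2
      simp only [List.nil_append, List.isChain_cons_cons] at h2
      have := h2.1
      omega
    have hr : r.headD 0 < v := IsMarked.headD_lt hw.tail h0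
    have hr' : r.headD 0 < N := hr.trans hv
    have hcongr := shapeWeight_congr_left t a d hr hr'
    have hxN : x < N := hx.trans hv
    have e1 : ¬ v < x := by omega
    have e2 : ¬ N < x := by omega
    have e3 : ¬ N < v := by omega
    have e4 : ¬ N < r.headD 0 := by omega
    have e5 : ¬ v < r.headD 0 := by omega
    have e6 : v ≠ N := by omega
    simp only [slotFillings, List.mem_cons, List.not_mem_nil, or_false] at hm
    rcases hm with rfl | rfl | rfl | rfl <;>
      simp only [shapeWeight, letterWeight, fillingWeight, List.nil_append, List.cons_append,
        List.headD_cons, hcongr] <;>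
      simp [-List.headD_eq_head?_getD, e1, e2, e3, e4, e5, e6, e6.symm, hv]
  | cons y l ih =>
    simp only [List.cons_append, shapeWeight]
    rw [ih hw.tail]
    have : letterWeight t a d x y ((l ++ (m ++ r)).headD 0) =
        letterWeight t a d x y ((l ++ N :: r).headD 0) := by
      cases l with
      | nil =>
        have hy : y < v := by
          have h1 := hw.1 y (by simp)
          have h2 := hw.tail.2
          simp only [List.cons_append, List.nil_append, List.isChain_cons_cons] at h2
          have := h2.1
          omega
        have hyN : y < N := hy.trans hv
        simp only [slotFillings, List.mem_cons, List.not_mem_nil, or_false] at hm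
        rcases hm with rfl | rfl | rfl | rfl <;> simp [letterWeight, hy, hyN]
      | cons z l => rfl
    rw [this]
    ring

lemma wordWeight_replace {R : Type*} [CommSemiring R] (q t a d : R) {N v : ℕ} {l m r : List ℕ}
    (h0 : 0 < v) (hv : v < N) (hw : IsMarked N v (l ++ N :: r)) (hm : m ∈ slotFillings N v) :
    wordWeight q t a d (l ++ (m ++ r)) = wordWeight q t a d (l ++ N :: r) *
      (q ^ (l.count N + 2 * r.count N) * fillingWeight t a d N v m) := by
  have hrev : (l ++ (m ++ r)).reverse = r.reverse ++ (m.reverse ++ l.reverse) := by simp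
  have hrev' : (l ++ N :: r).reverse = r.reverse ++ N :: l.reverse := by simp
  have hm' : m.reverse ∈ slotFillings N v := by
    simp only [slotFillings, List.mem_cons, List.not_mem_nil, or_false] at hm ⊢
    rcases hm with rfl | rfl | rfl | rfl <;> simp
  have hw0 : IsMarked N v (0 :: (l ++ N :: r)) := by
    refine ⟨fun x hx => ?_, List.isChain_cons.mpr ⟨fun _ _ => Or.inl (by omega), hw.2⟩⟩
    rcases List.mem_cons.mp hx with rfl | hx
    · exact Or.inl h0
    · exact hw.1 x hx
  rw [wordWeight, wordWeight, shapeWeight_replace t a d h0 hv hw0 hm, resWord_replace h0 hv hw hm,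
    hrev, resWord_replace h0 hv (hrev' ▸ hw.reverse) hm', hrev', List.count_reverse]
  ring

/-- The ways to write a word as `l ++ N :: r`. -/
def markerSplits (N : ℕ) : List ℕ → List (List ℕ × List ℕ)
  | [] => []
  | x :: w => (if x = N then [([], w)] else []) ++
      (markerSplits N w).map fun p => (x :: p.1, p.2)

lemma mem_markerSplits {N : ℕ} {w : List ℕ} {p : List ℕ × List ℕ} :
    p ∈ markerSplits N w ↔ w = p.1 ++ N :: p.2 := by
  obtain ⟨l, r⟩ := p
  induction w generalizing l with
  | nil => simp [markerSplits]
  | cons x w ih =>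
    cases l with
    | nil =>
      by_cases h : x = N <;> simp [markerSplits, h, eq_comm]
      exact fun h' => absurd h'.symm h
    | cons y l =>
      by_cases h : x = N <;> simp [markerSplits, h, ih, eq_comm, and_comm]

lemma sum_markerSplits {R : Type*} [CommSemiring R] (q : R) (N : ℕ) (w : List ℕ) :
    ((markerSplits N w).map fun p => q ^ (p.1.count N + 2 * p.2.count N)).sum =
      slotWeight q (w.count N) := by
  induction w with
  | nil => rfl
  | cons x w ih =>
    by_cases h : x = N
    · simp [markerSplits, h, slotWeight, ← ih, Function.comp_def, ← List.sum_map_mul_left]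
      congr 2
      ext p
      ring_nf
    · simp [markerSplits, h, ← ih, Function.comp_def]

/-- All words obtained from `w` by inserting the letter `v` at a marker. -/
def insertLetter (N v : ℕ) (w : List ℕ) : List (List ℕ) :=
  (markerSplits N w).flatMap fun p => (slotFillings N v).map fun m => p.1 ++ (m ++ p.2)

lemma mem_insertLetter {N v : ℕ} {w u : List ℕ} :
    u ∈ insertLetter N v w ↔
      ∃ l r, w = l ++ N :: r ∧ ∃ m ∈ slotFillings N v, u = l ++ (m ++ r) := by
  simp [insertLetter, mem_markerSplits, eq_comm]

lemma IsMarked.insertLetter {N v : ℕ} {w u : List ℕ} (hw : IsMarked N v w) (hv : v < N)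
    (hu : u ∈ insertLetter N v w) : IsMarked N (v + 1) u := by
  obtain ⟨l, r, rfl, m, hm, rfl⟩ := mem_insertLetter.mp hu
  obtain ⟨h1, h2⟩ := hw
  simp only [slotFillings, List.mem_cons, List.not_mem_nil, or_false] at hm
  refine ⟨fun x hx => ?_, ?_⟩
  · have := h1 x
    rcases hm with rfl | rfl | rfl | rfl <;> simp at hx this <;> grind
  · rcases hm with rfl | rfl | rfl | rfl <;>
      simp [List.isChain_append, List.isChain_cons] at h2 ⊢ <;> grind

/-- All words obtained from `w` by successively inserting the letters of `vs` at markers, until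
no marker is left. -/
def fillWord (N : ℕ) : List ℕ → List ℕ → List (List ℕ)
  | [], w => if N ∈ w then [] else [w]
  | v :: vs, w => (insertLetter N v w).flatMap (fillWord N vs)

lemma sum_map_flatMap {α β M : Type*} [AddCommMonoid M] (l : List α) (f : α → List β)
    (g : β → M) : ((l.flatMap f).map g).sum = (l.map fun x => ((f x).map g).sum).sum := by
  induction l with
  | nil => rfl
  | cons x l ih => simp [ih]

lemma sum_insertLetter {R : Type*} [CommSemiring R] (q t a d : R) {N v : ℕ} {w : List ℕ}
    (h0 : 0 < v) (hv : v < N) (hw : IsMarked N v w) (g : ℕ → R) :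
    ((insertLetter N v w).map fun u => wordWeight q t a d u * g (u.count N)).sum =
      wordWeight q t a d w * (slotWeight q (w.count N) *
        (g (w.count N - 1) + (a + d) * g (w.count N) + t * g (w.count N + 1))) := by
  rw [← sum_markerSplits, ← List.sum_map_mul_right, ← List.sum_map_mul_left, insertLetter,
    sum_map_flatMap]
  congr 1
  refine List.map_congr_left fun p hp => ?_
  obtain rfl := mem_markerSplits.mp hp
  have hvN : v ≠ N := hv.ne
  have h (m) (hm : m ∈ slotFillings N v) := wordWeight_replace q t a d h0 hv hw hm
  have e1 := h [v] (by simp [slotFillings])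
  have e2 := h [N, v] (by simp [slotFillings])
  have e3 := h [v, N] (by simp [slotFillings])
  have e4 := h [N, v, N] (by simp [slotFillings])
  simp only [fillingWeight, List.cons_append, List.nil_append] at e1 e2 e3 e4
  simp [slotFillings, e1, e2, e3, e4, hvN, hvN.symm]
  ring_nf

lemma sum_fillWord {R : Type*} [CommSemiring R] (q t a d : R) {N v m : ℕ} {w : List ℕ}
    (h0 : 0 < v) (hv : v + m ≤ N) (hw : IsMarked N v w) :
    ((fillWord N (List.range' v m) w).map (wordWeight q t a d)).sum =
      wordWeight q t a d w * pathWeight q t (a + d) m (w.count N) := by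
  induction m generalizing v w with
  | zero =>
    by_cases h : N ∈ w
    · simp [fillWord, pathWeight, h, List.count_eq_zero]
    · simp [fillWord, pathWeight, h, List.count_eq_zero]
  | succ m ih =>
    have hs := sum_insertLetter q t a d h0 (by omega) hw (pathWeight q t (a + d) m)
    rw [List.range'_succ, fillWord, sum_map_flatMap,
      List.map_congr_left fun u hu => ih (by omega) (by omega) (hw.insertLetter (by omega) hu), hs]
    congr 1
    cases w.count N with
    | zero => simp [slotWeight, pathWeight]
    | succ k => rfl

/-- Prepend a marker unless the word already starts with one. -/
def consMarker (N : ℕ) (w : List ℕ) : List ℕ := if w.headD 0 = N then w else N :: w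

/-- Replace each maximal run of letters greater than `m` by a single marker `N`. -/
def collapse (N m : ℕ) : List ℕ → List ℕ
  | [] => []
  | x :: u => if x ≤ m then x :: collapse N m u else consMarker N (collapse N m u)

lemma cons_mem_insertLetter {N v x : ℕ} {w u : List ℕ} (h : u ∈ insertLetter N v w) :
    x :: u ∈ insertLetter N v (x :: w) := by
  obtain ⟨l, r, rfl, m, hm, rfl⟩ := mem_insertLetter.mp h
  exact mem_insertLetter.mpr ⟨x :: l, r, rfl, m, hm, rfl⟩

lemma consMarker_mem_insertLetter {N v : ℕ} {w u : List ℕ} (hv : v ≠ N)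
    (h : u ∈ insertLetter N v w) : consMarker N u ∈ insertLetter N v (consMarker N w) := by
  obtain ⟨l, r, rfl, m, hm, rfl⟩ := mem_insertLetter.mp h
  cases l with
  | nil =>
    refine mem_insertLetter.mpr ⟨[], r, by simp [consMarker], ?_⟩
    simp only [slotFillings, List.mem_cons, List.not_mem_nil, or_false] at hm
    rcases hm with rfl | rfl | rfl | rfl <;> simp [consMarker, slotFillings, hv]
  | cons y l =>
    by_cases hy : y = N
    · simpa [consMarker, hy] using h
    · simpa [consMarker, hy] using cons_mem_insertLetter (x := N) h

lemma mem_insertLetter_consMarker {N v : ℕ} (hN : 0 < N) (w : List ℕ) :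
    v :: w ∈ insertLetter N v (consMarker N w) := by
  rw [mem_insertLetter]
  cases w with
  | nil => exact ⟨[], [], by simp [consMarker, hN.ne], [v], by simp [slotFillings]⟩
  | cons y w =>
    by_cases hy : y = N
    · exact ⟨[], w, by simp [consMarker, hy], [v, N], by simp [slotFillings, hy]⟩
    · exact ⟨[], y :: w, by simp [consMarker, hy], [v], by simp [slotFillings]⟩

lemma collapse_succ_of_notMem {N m : ℕ} {u : List ℕ} (h : m + 1 ∉ u) :
    collapse N (m + 1) u = collapse N m u := by
  induction u with
  | nil => rfl
  | cons x u ih =>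
    simp only [List.mem_cons, not_or] at h
    rw [collapse, collapse, ih h.2]
    exact if_congr (by omega) rfl rfl

lemma collapse_succ_mem_insertLetter {N m : ℕ} {u : List ℕ} (hm : m + 1 < N) (hu : u.Nodup)
    (hmem : m + 1 ∈ u) : collapse N (m + 1) u ∈ insertLetter N (m + 1) (collapse N m u) := by
  induction u with
  | nil => simp at hmem
  | cons x u ih =>
    rw [List.nodup_cons] at hu
    rcases List.mem_cons.mp hmem with rfl | h
    · rw [collapse, collapse, if_pos le_rfl, if_neg (by omega), collapse_succ_of_notMem hu.1]
      exact mem_insertLetter_consMarker (by omega) _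
    · have hx : x ≠ m + 1 := fun hx => hu.1 (hx ▸ h)
      rw [collapse, collapse]
      by_cases hxm : x ≤ m
      · rw [if_pos (by omega : x ≤ m + 1), if_pos hxm]
        exact cons_mem_insertLetter (ih hu.2 h)
      · rw [if_neg (by omega : ¬ x ≤ m + 1), if_neg hxm]
        exact consMarker_mem_insertLetter (by omega) (ih hu.2 h)

lemma collapse_eq_self {N m : ℕ} {u : List ℕ} (h : ∀ x ∈ u, x ≤ m) : collapse N m u = u := by
  induction u with
  | nil => rfl
  | cons x u ih =>
    rw [collapse, if_pos (h x (by simp)), ih fun y hy => h y (List.mem_cons_of_mem _ hy)]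

lemma collapse_zero {N : ℕ} {u : List ℕ} (hN : 0 < N) (h : ∀ x ∈ u, 0 < x) (hu : u ≠ []) :
    collapse N 0 u = [N] := by
  induction u with
  | nil => exact absurd rfl hu
  | cons x u ih =>
    rw [collapse, if_neg (by simpa using (h x (by simp)).ne')]
    cases u with
    | nil => simp [collapse, consMarker, hN.ne]
    | cons y u =>
      rw [ih (fun z hz => h z (List.mem_cons_of_mem _ hz)) (by simp)]
      simp [consMarker]

lemma mem_fillWord_collapse {n N m k : ℕ} {u : List ℕ} (hn : n < N) (hu : u.Nodup)
    (hmem : ∀ i, i ∈ u ↔ 1 ≤ i ∧ i ≤ n) (hmk : m + k = n) :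
    u ∈ fillWord N (List.range' (m + 1) k) (collapse N m u) := by
  induction k generalizing m with
  | zero =>
    rw [collapse_eq_self fun x hx => by have := (hmem x).mp hx; omega]
    have : N ∉ u := fun h => by have := (hmem N).mp h; omega
    simp [fillWord, this]
  | succ k ih =>
    rw [List.range'_succ, fillWord, List.mem_flatMap]
    exact ⟨_, collapse_succ_mem_insertLetter (by omega) hu ((hmem _).mpr (by omega)),
      ih (by omega)⟩

/-- The word `σ(1) … σ(n)`. -/
def permWord (n : ℕ) (σ : Equiv.Perm (Fin n)) : List ℕ := (List.range' 1 n).map (pval n σ)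

lemma pval_succ {n : ℕ} (σ : Equiv.Perm (Fin n)) (i : Fin n) :
    pval n σ (i + 1) = σ i + 1 := by
  have : 1 ≤ (i : ℕ) + 1 ∧ (i : ℕ) + 1 ≤ n := by omega
  simp [pval, this]

lemma pval_of_not {n i : ℕ} (σ : Equiv.Perm (Fin n)) (hi : ¬ (1 ≤ i ∧ i ≤ n)) :
    pval n σ i = 0 := dif_neg hi

lemma exists_fin_of_mem {n i : ℕ} (hi : 1 ≤ i ∧ i ≤ n) : ∃ j : Fin n, i = j + 1 :=
  ⟨⟨i - 1, by omega⟩, by simp; omega⟩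

lemma pval_injOn {n i j : ℕ} (σ : Equiv.Perm (Fin n)) (hi : 1 ≤ i ∧ i ≤ n) (hj : 1 ≤ j ∧ j ≤ n)
    (h : pval n σ i = pval n σ j) : i = j := by
  obtain ⟨i, rfl⟩ := exists_fin_of_mem hi
  obtain ⟨j, rfl⟩ := exists_fin_of_mem hj
  rw [pval_succ, pval_succ, Nat.add_right_cancel_iff, Fin.val_inj, σ.apply_eq_iff_eq] at h
  rw [h]

lemma nodup_permWord {n : ℕ} (σ : Equiv.Perm (Fin n)) : (permWord n σ).Nodup := by
  refine List.Nodup.map_on (fun i hi j hj h => ?_) List.nodup_range'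
  simp only [List.mem_range'_1] at hi hj
  exact pval_injOn σ (by omega) (by omega) h

lemma mem_permWord {n i : ℕ} (σ : Equiv.Perm (Fin n)) : i ∈ permWord n σ ↔ 1 ≤ i ∧ i ≤ n := by
  simp only [permWord, List.mem_map, List.mem_range'_1]
  constructor
  · rintro ⟨j, hj, rfl⟩
    obtain ⟨j, rfl⟩ := exists_fin_of_mem (n := n) (i := j) (by omega)
    rw [pval_succ]
    omega
  · intro hi
    obtain ⟨i, rfl⟩ := exists_fin_of_mem hi
    refine ⟨(σ.symm i : ℕ) + 1, by omega, ?_⟩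
    rw [pval_succ, σ.apply_symm_apply]

lemma permWord_injective (n : ℕ) : Function.Injective (permWord n) := by
  intro σ τ h
  ext i
  have := List.map_inj_left.mp h (i + 1) (by simp [List.mem_range'_1]; omega)
  rw [pval_succ, pval_succ] at this
  omega

lemma isMarked_singleton (N v : ℕ) : IsMarked N v [N] := ⟨by simp, by simp⟩

lemma length_fillWord {n : ℕ} (hn : 0 < n) :
    (fillWord (n + 1) (List.range' 1 n) [n + 1]).length = n.factorial := by
  obtain ⟨m, rfl⟩ : ∃ m, n = m + 1 := ⟨n - 1, by omega⟩
  have hone : wordWeight (1 : ℕ) 1 1 1 = fun _ => 1 := by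
    have : ∀ x w, shapeWeight (1 : ℕ) 1 1 x w = 1 := by
      intro x w
      induction w generalizing x with
      | nil => rfl
      | cons y w ih => simp [shapeWeight, letterWeight, ih]
    ext w
    simp [wordWeight, this]
  have := sum_fillWord (1 : ℕ) 1 1 1 (N := m + 1 + 1) one_pos (by omega : 1 + (m + 1) ≤ m + 1 + 1)
    (isMarked_singleton _ _)
  simpa [hone, pathWeight_one m 0] using this

lemma sum_permWord {n : ℕ} (hn : 0 < n) {M : Type*} [AddCommMonoid M] (f : List ℕ → M) :
    ∑ σ, f (permWord n σ) = ((fillWord (n + 1) (List.range' 1 n) [n + 1]).map f).sum := by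
  have hmem : ∀ σ, permWord n σ ∈ fillWord (n + 1) (List.range' 1 n) [n + 1] := by
    intro σ
    have := mem_fillWord_collapse (Nat.lt_succ_self n) (nodup_permWord σ)
      (fun _ => mem_permWord σ) (zero_add n)
    rwa [collapse_zero (Nat.succ_pos n) (fun x hx => ((mem_permWord σ).mp hx).1)
      (List.ne_nil_of_mem ((mem_permWord σ).mpr ⟨le_rfl, hn⟩))] at this
  have heq : (Finset.univ.val.map (permWord n) : Multiset (List ℕ)) =
      (fillWord (n + 1) (List.range' 1 n) [n + 1] : Multiset (List ℕ)) := by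
    refine Multiset.eq_of_le_of_card_le ((Multiset.le_iff_subset
      (Finset.univ.nodup.map (permWord_injective n))).mpr fun w hw => ?_) ?_
    · obtain ⟨σ, -, rfl⟩ := Multiset.mem_map.mp hw
      exact hmem σ
    · simp [length_fillWord hn, Fintype.card_perm]
  have := congrArg (fun s => (s.map f).sum) heq
  rwa [Multiset.map_map, Multiset.map_coe, Multiset.sum_coe] at this

lemma sum_wordWeight {R : Type*} [CommSemiring R] (q t a d : R) {n : ℕ} (hn : 0 < n) :
    ∑ σ, wordWeight q t a d (permWord n σ) = pathWeight q t (a + d) n 1 := by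
  rw [sum_permWord hn, sum_fillWord q t a d one_pos (by omega) (isMarked_singleton _ _)]
  have h : wordWeight q t a d [n + 1] = 1 := by
    simp [wordWeight, resWord, upAcross, shapeWeight, letterWeight]
  rw [h, one_mul, List.count_singleton_self]

section FunctionWords

variable (f : ℕ → ℕ)

lemma headD_map_range' {i m : ℕ} (h : f (i + m) = 0) :
    ((List.range' i m).map f).headD 0 = f i := by
  cases m with
  | zero => exact h.symm
  | succ m => simp [List.range'_succ]

lemma upAcross_map_range' (c : ℕ) {i m : ℕ} (h : f (i + m) = 0) :
    upAcross c ((List.range' i m).map f) =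
      ∑ j ∈ Finset.Ico i (i + m), if f j < c ∧ c < f (j + 1) then 1 else 0 := by
  induction m generalizing i with
  | zero => simp [upAcross]
  | succ m ih =>
    have h' : f (i + 1 + m) = 0 := by rwa [show i + 1 + m = i + (m + 1) by omega]
    rw [List.range'_succ, List.map_cons, upAcross, headD_map_range' f h', ih h',
      Finset.sum_eq_sum_Ico_succ_bot (show i < i + (m + 1) by omega),
      show i + 1 + m = i + (m + 1) by omega]

lemma resWord_map_range' {i m : ℕ} (h : f (i + m) = 0) :
    resWord ((List.range' i m).map f) =
      ∑ a ∈ Finset.Ico i (i + m), ∑ j ∈ Finset.Ico (a + 1) (i + m),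
        if f j < f a ∧ f a < f (j + 1) then 1 else 0 := by
  induction m generalizing i with
  | zero => simp [resWord]
  | succ m ih =>
    have h' : f (i + 1 + m) = 0 := by rwa [show i + 1 + m = i + (m + 1) by omega]
    rw [List.range'_succ, List.map_cons, resWord, upAcross_map_range' f _ h', ih h',
      Finset.sum_eq_sum_Ico_succ_bot (show i < i + (m + 1) by omega),
      show i + 1 + m = i + (m + 1) by omega]

lemma resWord_map_range'_one {n : ℕ} (h : f (n + 1) = 0) :
    resWord ((List.range' 1 n).map f) = ((Finset.Icc 1 n ×ˢ Finset.Icc 1 n).filter fun p =>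
      p.1 < p.2 ∧ f p.2 < f p.1 ∧ f p.1 < f (p.2 + 1)).card := by
  rw [resWord_map_range' f (by rwa [add_comm]), Finset.card_filter, Finset.sum_product]
  refine Finset.sum_congr (by ext; simp; omega) fun a ha => ?_
  rw [← Finset.sum_filter, ← Finset.sum_filter]
  refine Finset.sum_congr ?_ fun _ _ => rfl
  ext j
  simp only [Finset.mem_filter, Finset.mem_Ico, Finset.mem_Icc] at ha ⊢
  constructor
  · rintro ⟨h1, h2⟩
    exact ⟨by omega, by omega, h2⟩
  · rintro ⟨h1, h2, h3⟩
    exact ⟨by omega, h3⟩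

lemma shapeWeight_map_range' {R : Type*} [CommSemiring R] (t a d : R) {i m : ℕ}
    (h : f (i + 1 + m) = 0) :
    shapeWeight t a d (f i) ((List.range' (i + 1) m).map f) =
      ∏ j ∈ Finset.range m, letterWeight t a d (f (i + j)) (f (i + j + 1)) (f (i + j + 2)) := by
  induction m generalizing i with
  | zero => rfl
  | succ m ih =>
    have h' : f (i + 1 + 1 + m) = 0 := by rwa [show i + 1 + 1 + m = i + 1 + (m + 1) by omega]
    rw [List.range'_succ, List.map_cons, shapeWeight, headD_map_range' f h', ih h',
      Finset.prod_range_succ', mul_comm]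
    congr 1
    refine Finset.prod_congr rfl fun j _ => ?_
    rw [show i + 1 + j = i + (j + 1) by omega]

lemma reverse_map_range' (n : ℕ) :
    ((List.range' 1 n).map f).reverse = (List.range' 1 n).map fun i => f (n + 1 - i) := by
  refine List.ext_getElem (by simp) fun i h1 h2 => ?_
  simp only [List.length_reverse, List.length_map, List.length_range'] at h1
  simp only [List.getElem_reverse, List.getElem_map, List.getElem_range', List.length_map,
    List.length_range']
  congr 1
  omega

end FunctionWords

lemma resWord_permWord {n : ℕ} (σ : Equiv.Perm (Fin n)) :
    resWord (permWord n σ) = res n σ := by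
  have h : pval n σ (n + 1) = 0 := pval_of_not σ (by omega)
  rw [permWord, resWord_map_range'_one _ h, res]
  congr 1
  ext ⟨i, j⟩
  simp only [Finset.mem_filter, Finset.mem_product, Finset.mem_Icc]
  constructor
  · rintro ⟨h1, h2, h3, h4⟩
    have : j ≠ n := by
      rintro rfl
      omega
    exact ⟨by omega, h2, h3, h4⟩
  · rintro ⟨h1, h2⟩
    exact ⟨by omega, h2⟩

lemma resWord_reverse_permWord {n : ℕ} (σ : Equiv.Perm (Fin n)) :
    resWord (permWord n σ).reverse = les n σ := by
  have h : pval n σ 0 = 0 := pval_of_not σ (by omega)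
  rw [permWord, reverse_map_range', resWord_map_range'_one _ (by simpa using h), les]
  refine Finset.card_nbij' (fun p => (n + 1 - p.2, n + 1 - p.1))
    (fun p => (n + 1 - p.2, n + 1 - p.1)) ?_ ?_ ?_ ?_
  · rintro ⟨i, j⟩ hp
    simp only [Finset.coe_filter, Finset.mem_product, Finset.mem_Icc, Set.mem_ofPred_eq] at hp ⊢
    obtain ⟨h1, h2, h3, h4⟩ := hp
    rw [show n + 1 - (j + 1) = n + 1 - j - 1 by omega] at h4
    have : j ≠ n := by
      rintro rfl
      rw [show j + 1 - j - 1 = 0 by omega] at h4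
      omega
    exact ⟨by omega, by omega, h4, h3⟩
  · rintro ⟨i, j⟩ hp
    simp only [Finset.coe_filter, Finset.mem_product, Finset.mem_Icc, Set.mem_ofPred_eq] at hp ⊢
    obtain ⟨h1, h2, h3, h4⟩ := hp
    refine ⟨by omega, by omega, ?_, ?_⟩
    · rwa [show n + 1 - (n + 1 - i) = i by omega, show n + 1 - (n + 1 - j) = j by omega]
    · rwa [show n + 1 - (n + 1 - j) = j by omega, show n + 1 - (n + 1 - i + 1) = i - 1 by omega]
  · rintro ⟨i, j⟩ hp
    simp only [Finset.coe_filter, Finset.mem_product, Finset.mem_Icc, Set.mem_ofPred_eq] at hp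
    simp only [Prod.mk.injEq]
    omega
  · rintro ⟨i, j⟩ hp
    simp only [Finset.coe_filter, Finset.mem_product, Finset.mem_Icc, Set.mem_ofPred_eq] at hp
    simp only [Prod.mk.injEq]
    omega

lemma pval_succ_ne {n i : ℕ} (σ : Equiv.Perm (Fin n)) (hi : i ≤ n) (hn : 0 < n) :
    pval n σ (i + 1) ≠ pval n σ i := by
  intro h
  have pos : ∀ j, 1 ≤ j ∧ j ≤ n → 0 < pval n σ j := fun j hj => by
    obtain ⟨j, rfl⟩ := exists_fin_of_mem hj
    rw [pval_succ]
    omega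
  rcases Nat.eq_zero_or_pos i with rfl | h0
  · have := pos 1 (by omega)
    rw [pval_of_not σ (i := 0) (by omega)] at h
    simp at h
    omega
  · rcases hi.eq_or_lt with rfl | h1
    · have := pos i (by omega)
      rw [pval_of_not σ (i := i + 1) (by omega)] at h
      omega
    · have := pval_injOn σ (by omega) (by omega) h
      omega

/-- Number of double ascents, with the same boundary convention as for valleys. -/
def dascs (n : ℕ) (σ : Equiv.Perm (Fin n)) : ℕ :=
  ((Finset.Icc 1 n).filter fun i =>
    pval n σ (i - 1) < pval n σ i ∧ pval n σ i < pval n σ (i + 1)).card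

lemma two_mul_valleys_add {n : ℕ} (σ : Equiv.Perm (Fin n)) (hn : 0 < n) :
    2 * valleys n σ + dascs n σ + ddes n σ = n - 1 := by
  have hne : ∀ i, 1 ≤ i ∧ i ≤ n →
      pval n σ i ≠ pval n σ (i - 1) ∧ pval n σ (i + 1) ≠ pval n σ i := fun i hi =>
    ⟨by simpa [show i - 1 + 1 = i by omega] using pval_succ_ne σ (i := i - 1) (by omega) hn,
      pval_succ_ne σ hi.2 hn⟩
  have asc : valleys n σ + dascs n σ =
      ((Finset.Icc 1 (n - 1)).filter fun i => pval n σ i < pval n σ (i + 1)).card := by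
    rw [valleys, dascs, ← Finset.card_union_of_disjoint]
    · congr 1
      ext i
      simp only [Finset.mem_union, Finset.mem_filter, Finset.mem_Icc]
      have h0 : i = n → pval n σ (i + 1) = 0 := fun h => pval_of_not σ (by omega)
      have := hne i
      omega
    · rw [Finset.disjoint_filter]
      omega
  have desc : valleys n σ + ddes n σ =
      ((Finset.Icc 1 (n - 1)).filter fun i => ¬ pval n σ i < pval n σ (i + 1)).card := by
    rw [valleys, ddes, ← Finset.card_union_of_disjoint]
    · refine Finset.card_nbij' (fun i => i - 1) (fun i => i + 1) ?_ ?_ ?_ ?_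
      · intro i hi
        simp only [Finset.coe_union, Finset.coe_filter, Finset.mem_Icc, Set.mem_union,
          Set.mem_ofPred_eq] at hi ⊢
        have h0 : i = 1 → pval n σ (i - 1) = 0 := fun h => pval_of_not σ (by omega)
        rw [show i - 1 + 1 = i by omega]
        omega
      · intro i hi
        simp only [Finset.coe_union, Finset.coe_filter, Finset.mem_Icc, Set.mem_union,
          Set.mem_ofPred_eq] at hi ⊢
        have h1 := (hne i (by omega)).2
        have h2 := (hne (i + 1) (by omega)).2
        rw [show i + 1 - 1 = i by omega]
        omega
      · intro i hi
        simp only [Finset.coe_union, Finset.coe_filter, Finset.mem_Icc, Set.mem_union,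
          Set.mem_ofPred_eq] at hi
        dsimp only
        omega
      · intro i hi
        dsimp only
        omega
    · rw [Finset.disjoint_filter]
      omega
  have := Finset.card_filter_add_card_filter_not (s := Finset.Icc 1 (n - 1))
    (fun i => pval n σ i < pval n σ (i + 1))
  rw [Nat.card_Icc] at this
  omega

lemma shapeWeight_permWord {R : Type*} [CommSemiring R] (t a : R) {n : ℕ} (hn : 0 < n)
    (σ : Equiv.Perm (Fin n)) :
    shapeWeight t a 0 0 (permWord n σ) =
      if ddes n σ = 0 then t ^ valleys n σ * a ^ (n - 1 - 2 * valleys n σ) else 0 := by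
  have h0 : pval n σ 0 = 0 := pval_of_not σ (by omega)
  have h1 := shapeWeight_map_range' (pval n σ) t a 0 (i := 0) (m := n)
    (pval_of_not σ (by omega))
  rw [h0] at h1
  have h2 : shapeWeight t a 0 0 (permWord n σ) = ∏ i ∈ Finset.Icc 1 n,
      letterWeight t a 0 (pval n σ (i - 1)) (pval n σ i) (pval n σ (i + 1)) := by
    rw [permWord, show Finset.Icc 1 n = Finset.Ico 1 (n + 1) from rfl,
      Finset.prod_Ico_eq_prod_range]
    refine h1.trans (Finset.prod_congr (by simp) fun j _ => ?_)
    rw [show 1 + j - 1 = 0 + j by omega, show 1 + j = 0 + j + 1 by omega]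
  rw [h2]
  split_ifs with hd
  · have h3 := two_mul_valleys_add σ hn
    rw [show n - 1 - 2 * valleys n σ = dascs n σ by omega, valleys, dascs,
      ← Finset.prod_const, ← Finset.prod_const, Finset.prod_filter, Finset.prod_filter,
      ← Finset.prod_mul_distrib]
    refine Finset.prod_congr rfl fun i hi => ?_
    have hi' := Finset.mem_Icc.mp hi
    have h4 : pval n σ i ≠ pval n σ (i - 1) := by
      simpa [show i - 1 + 1 = i by omega] using pval_succ_ne σ (i := i - 1) (by omega) hn
    have h5 : pval n σ (i + 1) ≠ pval n σ i := pval_succ_ne σ hi'.2 hn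
    have h6 := Finset.filter_eq_empty_iff.mp (Finset.card_eq_zero.mp hd) hi
    unfold letterWeight
    by_cases h7 : pval n σ i < pval n σ (i - 1) <;> by_cases h8 : pval n σ i < pval n σ (i + 1)
    · simp [h7, h8, h7.not_gt]
    · exact absurd ⟨h7, by omega⟩ h6
    · simp [h7, h8, show pval n σ (i - 1) < pval n σ i by omega]
    · simp [h7, h8]
  · obtain ⟨i, hi⟩ := Finset.card_ne_zero.mp hd
    obtain ⟨hi, h3, h4⟩ := Finset.mem_filter.mp hi
    refine Finset.prod_eq_zero hi ?_
    rw [letterWeight, if_pos h3, if_neg h4.not_gt]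

lemma sum_Icc_one_eq_sum_fin {M : Type*} [AddCommMonoid M] (n : ℕ) (g : ℕ → M) :
    ∑ i ∈ Finset.Icc 1 n, g i = ∑ i : Fin n, g (i + 1) := by
  rw [Fin.sum_univ_eq_sum_range (fun i => g (i + 1)),
    show Finset.Icc 1 n = Finset.Ico 1 (n + 1) from rfl, Finset.sum_Ico_eq_sum_range]
  simp [add_comm]

lemma inv_eq_invCount {n : ℕ} (σ : Equiv.Perm (Fin n)) : inv n σ = invCount σ := by
  rw [inv, Finset.card_filter, Finset.sum_product, sum_Icc_one_eq_sum_fin, invCount]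
  refine Finset.sum_congr rfl fun i _ => ?_
  rw [sum_Icc_one_eq_sum_fin]
  refine Finset.sum_congr rfl fun j _ => if_congr ?_ rfl rfl
  simp only [pval_succ, Fin.lt_def]
  omega

lemma exc_eq_excCount {n : ℕ} (σ : Equiv.Perm (Fin n)) : exc n σ = excCount σ := by
  rw [exc, Finset.card_filter, sum_Icc_one_eq_sum_fin, excCount]
  refine Finset.sum_congr rfl fun i _ => if_congr ?_ rfl rfl
  rw [pval_succ, Fin.lt_def]
  omega

lemma sum_inv_exc_eq_pathWeight {R : Type*} [CommSemiring R] (q t : R) {n : ℕ} (hn : 0 < n) :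
    ∑ σ : Equiv.Perm (Fin n), q ^ (inv n σ - exc n σ) * t ^ exc n σ =
      pathWeight q t (1 + t) n 1 := by
  obtain ⟨m, rfl⟩ : ∃ m, n = m + 1 := ⟨n - 1, by omega⟩
  have := cornerSum_eq_pathWeight q t m 0
  simpa [cornerSum, AvoidsCorner, inv_eq_invCount, exc_eq_excCount] using this

/-- The Blanco–Petersen expansion holds with
`γ_{n,k}(q) = Σ_{σ ∈ S_{n,k}} q^(2·res σ + les σ)`. -/
theorem statement1 (n : ℕ) (hn : 0 < n) :
    (∑ σ : Equiv.Perm (Fin n),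
      (X 0 : MvPolynomial (Fin 2) ℤ) ^ (inv n σ - exc n σ) * (X 1) ^ (exc n σ)) =
    ∑ k ∈ Finset.range ((n - 1) / 2 + 1),
      (∑ σ ∈ Snk n k, (X 0 : MvPolynomial (Fin 2) ℤ) ^ (2 * res n σ + les n σ)) *
        (X 1) ^ k * (1 + X 1) ^ (n - 1 - 2 * k) := by
  rw [sum_inv_exc_eq_pathWeight _ _ hn]
  have h := sum_wordWeight (X 0 : MvPolynomial (Fin 2) ℤ) (X 1) (1 + X 1) 0 hn
  rw [add_zero] at h
  simp only [wordWeight, resWord_permWord, resWord_reverse_permWord,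
    shapeWeight_permWord _ _ hn, mul_ite, mul_zero] at h
  rw [← h, ← Finset.sum_filter, ← Finset.sum_fiberwise_of_maps_to
    (t := Finset.range ((n - 1) / 2 + 1)) (g := valleys n)]
  · refine Finset.sum_congr rfl fun k _ => ?_
    rw [Finset.sum_mul, Finset.sum_mul, Snk, Finset.filter_filter]
    refine Finset.sum_congr (Finset.filter_congr fun σ _ => and_comm) fun σ hσ => ?_
    rw [(Finset.mem_filter.mp hσ).2.1]
    ring
  · intro σ _
    have := two_mul_valleys_add σ hn
    rw [Finset.mem_range]
    omega
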